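/- Let ξ, ξ₁, ξ₂, … be iid random variables with values in [1/4,∞) satisfying −∞ < E log ξ < 0 and E|log(4ξ − 1)| < ∞, and suppose 4ξ ≥ a almost surely for some a ∈ (1,4). Consider the random logistic IFS Xₙ = ξₙ^{−1}X_{n−1}(1 − X_{n−1}) on (0,1), or equivalently its conjugation Wₙ = ξₙ(W_{n−1} + 1 + 1/(W_{n−1} − 1)) on [a,∞). If either a ≥ 1 + 2^{−1/2}, or a < 1 + 2^{−1/2} and E log ξ + log|1 − (a − 1)^{−2}| < 0, then the stationary distribution π of (Xₙ)ₙ≥₀ on (0,1) is unique. (Indeed, the Lipschitz constant of the convex map w ↦ ξ(w + 1 + 1/(w − 1)) on [a,∞) equals max(ξ|1 − (a − 1)^{−2}|, ξ), which equals ξ|1 − (a − 1)^{−2}| iff a ∈ (1, 1 + 2^{−1/2}], so that the stated conditions make the conjugated IFS mean contractive on [a,∞).) -/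

import Mathlib

open MeasureTheory ProbabilityTheory Filter Set

noncomputable section

/-- The Markov chain `X (n + 1) = f (X n, ω (inr n))` started at the coordinate `ω (inl b)`. -/
def randomOrbit (f : ℝ × ℝ → ℝ) (b : Bool) : ℕ → (Bool ⊕ ℕ → ℝ) → ℝ
  | 0, ω => ω (Sum.inl b)
  | n + 1, ω => f (randomOrbit f b n ω, ω (Sum.inr n))

lemma measurable_randomOrbit {f : ℝ × ℝ → ℝ} (hf : Measurable f) (b : Bool) (n : ℕ) :
    Measurable (randomOrbit f b n) := by
  induction n with
  | zero => exact measurable_pi_apply _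
  | succ n ih => exact hf.comp (ih.prodMk (measurable_pi_apply _))

lemma randomOrbit_congr (f : ℝ × ℝ → ℝ) (b : Bool) {n : ℕ} {ω ω' : Bool ⊕ ℕ → ℝ}
    (h₀ : ω (Sum.inl b) = ω' (Sum.inl b)) (h : ∀ i < n, ω (Sum.inr i) = ω' (Sum.inr i)) :
    randomOrbit f b n ω = randomOrbit f b n ω' := by
  induction n with
  | zero => exact h₀
  | succ n ih =>
    simp only [randomOrbit]
    rw [ih fun i hi => h i (by lia), h n (by lia)]

/-- The orbit at time `n` is independent of the noise used in the next step. -/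
lemma indepFun_randomOrbit {f : ℝ × ℝ → ℝ} (hf : Measurable f) {μ : Measure (Bool ⊕ ℕ → ℝ)}
    (hindep : iIndepFun (fun i (ω : Bool ⊕ ℕ → ℝ) => ω i) μ) (b : Bool) (n : ℕ) :
    IndepFun (randomOrbit f b n) (fun ω => ω (Sum.inr n)) μ := by
  classical
  let S : Finset (Bool ⊕ ℕ) := insert (Sum.inl b) ((Finset.range n).image Sum.inr)
  have hST : Disjoint S {Sum.inr n} := by simp [S]
  have h := hindep.indepFun_finset S {Sum.inr n} hST fun i => measurable_pi_apply i
  let extend : (S → ℝ) → (Bool ⊕ ℕ → ℝ) := fun g i => if hi : i ∈ S then g ⟨i, hi⟩ else 0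
  have hextend : Measurable extend := by
    refine measurable_pi_lambda _ fun i => ?_
    by_cases hi : i ∈ S
    · simpa [extend, hi] using measurable_pi_apply (⟨i, hi⟩ : S)
    · simp [extend, hi]
  have hcomp := h.comp ((measurable_randomOrbit hf b n).comp hextend)
    (measurable_pi_apply (⟨Sum.inr n, by simp⟩ : ({Sum.inr n} : Finset (Bool ⊕ ℕ))))
  have hrestrict : randomOrbit f b n =
      (randomOrbit f b n ∘ extend) ∘ fun (ω : Bool ⊕ ℕ → ℝ) (i : S) => ω i := by
    funext ω
    refine randomOrbit_congr f b ?_ fun i hi => ?_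
    · simp [extend, S]
    · simp [extend, S, hi]
  rw [hrestrict]
  exact hcomp

/-- An orbit started from a stationary law keeps this law. -/
lemma map_randomOrbit {f : ℝ × ℝ → ℝ} (hf : Measurable f) {μ : Measure (Bool ⊕ ℕ → ℝ)}
    [IsProbabilityMeasure μ] (hindep : iIndepFun (fun i (ω : Bool ⊕ ℕ → ℝ) => ω i) μ)
    {π ν : Measure ℝ} {b : Bool} (h₀ : μ.map (fun ω => ω (Sum.inl b)) = π)
    (hν : ∀ n, μ.map (fun ω => ω (Sum.inr n)) = ν) (hπ : (π.prod ν).map f = π) (n : ℕ) :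
    μ.map (randomOrbit f b n) = π := by
  induction n with
  | zero => exact h₀
  | succ n ih =>
    have hX := measurable_randomOrbit hf b n
    have hξ : Measurable fun ω : Bool ⊕ ℕ → ℝ => ω (Sum.inr n) := measurable_pi_apply _
    have h := (indepFun_randomOrbit hf hindep b n).map_prod_eq_prod_map_map
      hX.aemeasurable hξ.aemeasurable
    rw [ih, hν] at h
    rw [← h, Measure.map_map hf (hX.prodMk hξ)] at hπ
    exact hπ

/-- If orbits driven by the same noise from independent starting points merge almost surely,
then the stationary law is unique. -/
lemma stationary_unique_of_tendsto {f : ℝ × ℝ → ℝ} (hf : Measurable f)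
    {μ : Measure (Bool ⊕ ℕ → ℝ)} [IsProbabilityMeasure μ]
    {π : Bool → Measure ℝ} [∀ b, IsProbabilityMeasure (π b)]
    (hlaw : ∀ b n, μ.map (randomOrbit f b n) = π b)
    (h : ∀ᵐ ω ∂μ, Tendsto (fun n => randomOrbit f true n ω - randomOrbit f false n ω)
      atTop (nhds 0)) :
    π false = π true := by
  have hm := fun b n => (measurable_randomOrbit hf b n).aemeasurable (μ := μ)
  have key : ∀ b, TendstoInDistribution (randomOrbit f b) atTop (randomOrbit f b 0)
      (fun _ => μ) μ := fun b =>
    { forall_aemeasurable := hm b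
      aemeasurable_limit := hm b 0
      tendsto := by
        simp only [hlaw]
        exact tendsto_const_nhds }
  have hsub : TendstoInMeasure μ (randomOrbit f true - randomOrbit f false) atTop 0 :=
    tendstoInMeasure_of_tendsto_ae
      (fun n => ((hm true n).sub (hm false n)).aestronglyMeasurable) h
  have h₂ := tendstoInDistribution_of_tendstoInMeasure_sub _ _ (key false) hsub (hm true)
  rw [← hlaw false 0, ← hlaw true 0]
  exact tendstoInDistribution_unique _ h₂ (key true)

/-- In the coordinate `w = 1 / x` the logistic map is Lipschitz on `[a, ∞)`. -/
lemma abs_inv_logistic_sub_le {a t x y : ℝ} (ha : 1 < a) (ht : 0 < t)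
    (hx : x ∈ Ioc 0 a⁻¹) (hy : y ∈ Ioc 0 a⁻¹) :
    |(x * (1 - x) / t)⁻¹ - (y * (1 - y) / t)⁻¹| ≤
      t * max 1 |1 - ((a - 1) ^ 2)⁻¹| * |x⁻¹ - y⁻¹| := by
  have ha0 : 0 < a := by linarith
  have ha' : a⁻¹ < 1 := inv_lt_one_of_one_lt₀ ha
  have hfrac : ∀ z ∈ Ioc 0 a⁻¹, 0 < z / (1 - z) ∧ z / (1 - z) ≤ (a - 1)⁻¹ := by
    rintro z ⟨hz0, hz⟩
    have h1 : 0 < 1 - z := by linarith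
    refine ⟨div_pos hz0 h1, ?_⟩
    rw [div_le_iff₀ h1, inv_mul_eq_div, le_div_iff₀ (by linarith)]
    have : a * z ≤ 1 := by
      calc a * z ≤ a * a⁻¹ := by gcongr
        _ = 1 := mul_inv_cancel₀ ha0.ne'
    linarith
  obtain ⟨hx1, hx2⟩ := hfrac x hx
  obtain ⟨hy1, hy2⟩ := hfrac y hy
  have hprod : x / (1 - x) * (y / (1 - y)) ≤ ((a - 1) ^ 2)⁻¹ := by
    rw [← inv_pow, sq]
    gcongr
  have hx' : 1 - x ≠ 0 := by linarith [hx.2]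
  have hy' : 1 - y ≠ 0 := by linarith [hy.2]
  have hx0 := hx.1.ne'
  have hy0 := hy.1.ne'
  have heq : (x * (1 - x) / t)⁻¹ - (y * (1 - y) / t)⁻¹ =
      t * (1 - x / (1 - x) * (y / (1 - y))) * (x⁻¹ - y⁻¹) := by
    field_simp
    ring
  rw [heq, abs_mul, abs_mul, abs_of_pos ht]
  gcongr
  have := mul_pos hx1 hy1
  rw [abs_le]
  constructor
  · have := neg_abs_le (1 - ((a - 1) ^ 2)⁻¹)
    have := le_max_right 1 |1 - ((a - 1) ^ 2)⁻¹|
    linarith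
  · have := le_max_left 1 |1 - ((a - 1) ^ 2)⁻¹|
    linarith

lemma abs_sub_le_abs_inv_sub_inv {x y : ℝ} (hx : x ∈ Ioc 0 1) (hy : y ∈ Ioc 0 1) :
    |x - y| ≤ |x⁻¹ - y⁻¹| := by
  obtain ⟨hx0, hx1⟩ := hx
  obtain ⟨hy0, hy1⟩ := hy
  have h : x - y = x * y * (y⁻¹ - x⁻¹) := by field_simp
  rw [h, abs_mul, abs_sub_comm y⁻¹, abs_of_pos (mul_pos hx0 hy0)]
  exact mul_le_of_le_one_left (abs_nonneg _) (mul_le_one₀ hx1 hy0.le hy1)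

lemma logistic_mem_Ioc {a t x : ℝ} (ha : 1 < a) (ht : a ≤ 4 * t) (hx : x ∈ Ioo 0 1) :
    x * (1 - x) / t ∈ Ioc 0 a⁻¹ := by
  have ht0 : 0 < t := by linarith
  refine ⟨div_pos (mul_pos hx.1 (by linarith [hx.2])) ht0, ?_⟩
  rw [div_le_iff₀ ht0, inv_mul_eq_div, le_div_iff₀ (by linarith)]
  have h : x * (1 - x) ≤ 1 / 4 := by nlinarith [sq_nonneg (x - 1 / 2)]
  have h0 : 0 ≤ x * (1 - x) := mul_nonneg hx.1.le (by linarith [hx.2])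
  nlinarith

/-- Orbits merge when the noise has average contraction rate below zero. -/
lemma tendsto_logistic_orbit_sub {a c m : ℝ} (ha : 1 < a) (hc : 1 ≤ c)
    (hac : |1 - ((a - 1) ^ 2)⁻¹| ≤ c) (hm : m + Real.log c < 0) {ξ x y : ℕ → ℝ}
    (hξ : ∀ n, a ≤ 4 * ξ n)
    (hslln : Tendsto (fun n : ℕ => (∑ i ∈ Finset.range n, Real.log (ξ i)) / n) atTop (nhds m))
    (hx₀ : x 0 ∈ Ioc 0 a⁻¹) (hy₀ : y 0 ∈ Ioc 0 a⁻¹)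
    (hx : ∀ n, x (n + 1) = x n * (1 - x n) / ξ n)
    (hy : ∀ n, y (n + 1) = y n * (1 - y n) / ξ n) :
    Tendsto (fun n => x n - y n) atTop (nhds 0) := by
  have ha' : a⁻¹ < 1 := inv_lt_one_of_one_lt₀ ha
  have hξ0 : ∀ n, 0 < ξ n := fun n => by linarith [hξ n]
  have hc0 : 0 < c := by linarith
  have hmem : ∀ z : ℕ → ℝ, z 0 ∈ Ioc 0 a⁻¹ → (∀ n, z (n + 1) = z n * (1 - z n) / ξ n) →
      ∀ n, z n ∈ Ioc 0 a⁻¹ := by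
    intro z hz₀ hz n
    induction n with
    | zero => exact hz₀
    | succ n ih => exact hz n ▸ logistic_mem_Ioc ha (hξ n) ⟨ih.1, ih.2.trans_lt ha'⟩
  have hx_mem := hmem x hx₀ hx
  have hy_mem := hmem y hy₀ hy
  have hbound : ∀ n, |(x n)⁻¹ - (y n)⁻¹| ≤
      Real.exp ((∑ i ∈ Finset.range n, Real.log (ξ i)) + n * Real.log c) *
        |(x 0)⁻¹ - (y 0)⁻¹| := by
    intro n
    induction n with
    | zero => simp
    | succ n ih =>
      have hexp : Real.exp ((∑ i ∈ Finset.range (n + 1), Real.log (ξ i)) +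
          (n + 1 : ℕ) * Real.log c) = ξ n * c *
          Real.exp ((∑ i ∈ Finset.range n, Real.log (ξ i)) + n * Real.log c) := by
        have hsplit : (∑ i ∈ Finset.range (n + 1), Real.log (ξ i)) + (n + 1 : ℕ) * Real.log c =
            Real.log (ξ n) + Real.log c +
              ((∑ i ∈ Finset.range n, Real.log (ξ i)) + n * Real.log c) := by
          rw [Finset.sum_range_succ]
          push_cast
          ring
        rw [hsplit, Real.exp_add, Real.exp_add, Real.exp_log (hξ0 n), Real.exp_log hc0]
      rw [hexp, hx, hy, mul_assoc _ (Real.exp _)]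
      refine (abs_inv_logistic_sub_le ha (hξ0 n) (hx_mem n) (hy_mem n)).trans ?_
      have := (hξ0 n).le
      gcongr
      exact max_le hc hac
  have hexponent : Tendsto (fun n : ℕ => (∑ i ∈ Finset.range n, Real.log (ξ i)) +
      n * Real.log c) atTop atBot := by
    have h := tendsto_natCast_atTop_atTop (R := ℝ) |>.atTop_mul_neg hm
      (hslln.add_const (Real.log c))
    refine h.congr' ?_
    filter_upwards [eventually_gt_atTop 0] with n hn
    have : (n : ℝ) ≠ 0 := by positivity
    field_simp
  have hlim := (Real.tendsto_exp_atBot.comp hexponent).mul_const |(x 0)⁻¹ - (y 0)⁻¹|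
  rw [zero_mul] at hlim
  refine squeeze_zero_norm (fun n => ?_) hlim
  exact (abs_sub_le_abs_inv_sub_inv ⟨(hx_mem n).1, (hx_mem n).2.trans ha'.le⟩
    ⟨(hy_mem n).1, (hy_mem n).2.trans ha'.le⟩).trans (hbound n)

/-- The derivative bound `|1 - (a - 1)⁻²|` is at most one beyond `1 + 2^{-1/2}`. -/
lemma abs_one_sub_inv_sq_le_one {a : ℝ} (ha : 1 + (Real.sqrt 2)⁻¹ ≤ a) :
    |1 - ((a - 1) ^ 2)⁻¹| ≤ 1 := by
  have h2 : (2 : ℝ)⁻¹ ≤ (a - 1) ^ 2 := by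
    calc (2 : ℝ)⁻¹ = (Real.sqrt 2)⁻¹ ^ 2 := by rw [inv_pow, Real.sq_sqrt (by norm_num)]
      _ ≤ (a - 1) ^ 2 := by gcongr; linarith
  have h3 : ((a - 1) ^ 2)⁻¹ ≤ 2 := inv_le_of_inv_le₀ (by norm_num) h2
  have h4 : 0 ≤ ((a - 1) ^ 2)⁻¹ := by positivity
  rw [abs_le]
  constructor <;> linarith

lemma one_le_abs_one_sub_inv_sq {a : ℝ} (ha1 : 1 < a) (ha : a < 1 + (Real.sqrt 2)⁻¹) :
    1 ≤ |1 - ((a - 1) ^ 2)⁻¹| := by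
  have h2 : (a - 1) ^ 2 ≤ (2 : ℝ)⁻¹ := by
    calc (a - 1) ^ 2 ≤ (Real.sqrt 2)⁻¹ ^ 2 := by gcongr; linarith
      _ = (2 : ℝ)⁻¹ := by rw [inv_pow, Real.sq_sqrt (by norm_num)]
  have h0 : 0 < (a - 1) ^ 2 := pow_pos (by linarith) 2
  have h3 : 2 ≤ ((a - 1) ^ 2)⁻¹ := (le_inv_comm₀ (by norm_num) h0).2 h2
  rw [le_abs]
  right
  linarith

/-- A stationary law of the logistic chain charges only the range of the maps. -/
lemma ae_mem_Ioc_of_stationary {ν π : Measure ℝ} [IsProbabilityMeasure ν]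
    [IsProbabilityMeasure π] {a : ℝ} (ha : 1 < a) (hν : ∀ᵐ x ∂ν, a ≤ 4 * x)
    (hπ : π (Ioo 0 1) = 1)
    (hstat : (π.prod ν).map (fun q : ℝ × ℝ => q.1 * (1 - q.1) / q.2) = π) :
    ∀ᵐ x ∂π, x ∈ Ioc 0 a⁻¹ := by
  have hf : Measurable fun q : ℝ × ℝ => q.1 * (1 - q.1) / q.2 := by fun_prop
  rw [← hstat]
  refine (ae_map_iff hf.aemeasurable measurableSet_Ioc).2 ?_
  have h₁ : ∀ᵐ x ∂π, x ∈ Ioo (0 : ℝ) 1 := (mem_ae_iff_prob_eq_one measurableSet_Ioo).2 hπ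
  filter_upwards [Measure.quasiMeasurePreserving_fst.ae h₁,
    Measure.quasiMeasurePreserving_snd.ae hν] with q hq₁ hq₂
  exact logistic_mem_Ioc ha hq₂ hq₁

/-- The law of large numbers for the logarithms of iid variables. -/
lemma ae_tendsto_average_log {Ω : Type*} [MeasurableSpace Ω] {μ : Measure Ω} {ν : Measure ℝ}
    {ξ : ℕ → Ω → ℝ} (hindep : iIndepFun ξ μ) (hlaw : ∀ n, MeasurePreserving (ξ n) μ ν)
    (hint : Integrable Real.log ν) :
    ∀ᵐ ω ∂μ, Tendsto (fun n : ℕ => (∑ i ∈ Finset.range n, Real.log (ξ i ω)) / n) atTop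
      (nhds (∫ x, Real.log x ∂ν)) := by
  have hmean : ∫ ω, Real.log (ξ 0 ω) ∂μ = ∫ x, Real.log x ∂ν := by
    rw [← (hlaw 0).map_eq, integral_map (hlaw 0).aemeasurable
      Real.measurable_log.aestronglyMeasurable]
  rw [← hmean]
  refine strong_law_ae_real (fun i ω => Real.log (ξ i ω))
    ((hlaw 0).integrable_comp_of_integrable hint) (fun i j hij => ?_) fun i => ?_
  · exact (hindep.indepFun hij).comp Real.measurable_log Real.measurable_log
  · exact IdentDistrib.comp ⟨(hlaw i).aemeasurable, (hlaw 0).aemeasurable,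
      (hlaw i).map_eq.trans (hlaw 0).map_eq.symm⟩ Real.measurable_log

/-- **Uniqueness of the stationary law for random logistic transforms with bounded
noise.**  Let `ξ` take values in `[1/4,∞)` with `−∞ < E log ξ < 0`,
`E|log(4ξ−1)| < ∞`, and `4ξ ≥ a` a.s. for some `a ∈ (1,4)`.  If either
`a ≥ 1 + 2^{−1/2}`, or `a < 1 + 2^{−1/2}` and `E log ξ + log|1 − (a−1)^{−2}| < 0`,
then the stationary distribution of `Xₙ = ξₙ^{−1}X_{n−1}(1−X_{n−1})` on `(0,1)` is
unique. -/
theorem logistic_unique_stationary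
    (ν : Measure ℝ) [IsProbabilityMeasure ν]
    (hsupp : ∀ᵐ x ∂ν, (1 : ℝ) / 4 ≤ x)
    (hlogInt : Integrable Real.log ν)
    (hlogNeg : (∫ x, Real.log x ∂ν) < 0)
    (hlog4 : Integrable (fun x => |Real.log (4 * x - 1)|) ν)
    (a : ℝ) (ha1 : 1 < a) (ha4 : a < 4)
    (hbound : ∀ᵐ x ∂ν, a ≤ 4 * x)
    (hcontr : 1 + (Real.sqrt 2)⁻¹ ≤ a ∨
      (a < 1 + (Real.sqrt 2)⁻¹ ∧
        (∫ x, Real.log x ∂ν) + Real.log |1 - ((a - 1) ^ 2)⁻¹| < 0)) :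
    ∀ (π₁ π₂ : Measure ℝ) (_ : IsProbabilityMeasure π₁) (_ : IsProbabilityMeasure π₂),
      π₁ (Ioo 0 1) = 1 →
      Measure.map (fun q : ℝ × ℝ => q.1 * (1 - q.1) / q.2) (π₁.prod ν) = π₁ →
      π₂ (Ioo 0 1) = 1 →
      Measure.map (fun q : ℝ × ℝ => q.1 * (1 - q.1) / q.2) (π₂.prod ν) = π₂ →
      π₁ = π₂ := by
  intro π₁ π₂ _ _ hπ₁ hstat₁ hπ₂ hstat₂
  obtain ⟨c, hc, hac, hm⟩ : ∃ c : ℝ, 1 ≤ c ∧ |1 - ((a - 1) ^ 2)⁻¹| ≤ c ∧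
      (∫ x, Real.log x ∂ν) + Real.log c < 0 := by
    rcases hcontr with h | ⟨h, hneg⟩
    · exact ⟨1, le_rfl, abs_one_sub_inv_sq_le_one h, by simpa using hlogNeg⟩
    · exact ⟨_, one_le_abs_one_sub_inv_sq ha1 h, le_rfl, hneg⟩
  have hf : Measurable fun q : ℝ × ℝ => q.1 * (1 - q.1) / q.2 := by fun_prop
  set f := fun q : ℝ × ℝ => q.1 * (1 - q.1) / q.2
  let π : Bool → Measure ℝ := fun b => cond b π₂ π₁
  have hprob : ∀ b, IsProbabilityMeasure (π b) := by rintro (_ | _) <;> assumption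
  have hstat : ∀ b, ((π b).prod ν).map f = π b := by rintro (_ | _) <;> assumption
  have hsupport : ∀ b, ∀ᵐ x ∂π b, x ∈ Ioc 0 a⁻¹ := fun b =>
    ae_mem_Ioc_of_stationary ha1 hbound (by cases b <;> assumption) (hstat b)
  let P : Bool ⊕ ℕ → Measure ℝ := Sum.elim π fun _ => ν
  have hP : ∀ i, IsProbabilityMeasure (P i) := by
    rintro (b | n)
    · exact hprob b
    · exact inferInstanceAs (IsProbabilityMeasure ν)
  let μ := Measure.infinitePi P
  have hindep : iIndepFun (fun i (ω : Bool ⊕ ℕ → ℝ) => ω i) μ :=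
    iIndepFun_infinitePi (X := fun _ x => x) fun _ => measurable_id
  have hcoord : ∀ i, MeasurePreserving (fun ω : Bool ⊕ ℕ → ℝ => ω i) μ (P i) :=
    measurePreserving_eval_infinitePi P
  have hlaw : ∀ b n, μ.map (randomOrbit f b n) = π b := fun b n =>
    map_randomOrbit hf hindep (hcoord (Sum.inl b)).map_eq
      (fun n => (hcoord (Sum.inr n)).map_eq) (hstat b) n
  have hslln := ae_tendsto_average_log (hindep.precomp Sum.inr_injective) (fun n => hcoord (Sum.inr n)) hlogInt
  have hnoise : ∀ᵐ ω ∂μ, ∀ n, a ≤ 4 * ω (Sum.inr n) :=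
    ae_all_iff.2 fun n => (hcoord (Sum.inr n)).quasiMeasurePreserving.ae hbound
  have hstart : ∀ b, ∀ᵐ ω ∂μ, ω (Sum.inl b) ∈ Ioc 0 a⁻¹ := fun b =>
    (hcoord (Sum.inl b)).quasiMeasurePreserving.ae (hsupport b)
  refine stationary_unique_of_tendsto (π := π) hf hlaw ?_
  filter_upwards [hslln, hnoise, hstart true, hstart false] with ω h₁ h₂ h₃ h₄
  exact tendsto_logistic_orbit_sub ha1 hc hac hm h₂ h₁ h₃ h₄ (fun _ => rfl) fun _ => rfl
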